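/- Let n ≥ 2 and d ≥ 1, and extend the conjugation action of GL_n(C) on C[x_{ij} : 1 ≤ i,j ≤ n] to an action on C[x_0, x_{ij}] by letting every g ∈ GL_n(C) fix x_0. Then the characteristic polynomial φ_{gl_n(C)}(S^d(C^n)) of gl_n(C) on the d-th symmetric power, computed with respect to the standard basis {E_{ij}}, is invariant under this extended action; equivalently, each coefficient z_i of x_0^{m−i} in φ_{gl_n(C)}(S^d(C^n)) (where m = C(n+d−1,d)) is a conjugation invariant of GL_n(C). -/

import Mathlib

open MvPolynomial Matrix

noncomputable section

/-- The matrix of the derivation action of an `n × n` matrix `A` on the `d`-th symmetric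
power of the standard representation, with respect to the monomial basis indexed by
`Sym (Fin n) d`. -/
def symMat {R : Type*} [CommRing R] (n d : ℕ) (A : Matrix (Fin n) (Fin n) R) :
    Matrix (Sym (Fin n) d) (Sym (Fin n) d) R :=
  fun a b => ∑ i : Fin n, ∑ j : Fin n,
    if (b : Multiset (Fin n)) = ((a : Multiset (Fin n)).erase i) + {j}
    then (Multiset.count i (a : Multiset (Fin n)) : R) * A i j else 0

/-- The characteristic polynomial `det(x₀·I + M)`, viewed as a polynomial in `x₀` with
coefficients in the base (multivariate polynomial) ring. -/
def charP {m R : Type*} [Fintype m] [DecidableEq m] [CommRing R] (M : Matrix m m R) :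
    Polynomial R :=
  Matrix.det ((Polynomial.X : Polynomial R) • (1 : Matrix m m (Polynomial R)) + M.map Polynomial.C)

/-- The coefficient algebra: the subalgebra generated by all coefficients of the
characteristic polynomial. -/
def coeffAlg {m : Type*} [Fintype m] [DecidableEq m] (K : Type*) [CommRing K] {ι : Type*}
    (M : Matrix m m (MvPolynomial ι K)) : Subalgebra K (MvPolynomial ι K) :=
  Algebra.adjoin K (Set.range (charP M).coeff)

/-- The generic `n × n` matrix `X = (x_{ij})`. -/
def glGen (n : ℕ) : Matrix (Fin n) (Fin n) (MvPolynomial (Fin n × Fin n) ℂ) :=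
  fun i j => MvPolynomial.X (i, j)

/-- The algebra endomorphism of `ℂ[x_{ij}]` induced by the conjugation action of
`g ∈ GL_n(ℂ)` on the space of `n × n` matrices: it substitutes the variable `x_{ij}` by the
`(i,j)` entry of `g·X·g⁻¹`. -/
def glConj {n : ℕ} (g : GL (Fin n) ℂ) :
    MvPolynomial (Fin n × Fin n) ℂ →ₐ[ℂ] MvPolynomial (Fin n × Fin n) ℂ :=
  MvPolynomial.aeval fun p : Fin n × Fin n =>
    (((((g : Matrix (Fin n) (Fin n) ℂ).map MvPolynomial.C) * glGen n *
      (((g⁻¹ : GL (Fin n) ℂ) : Matrix (Fin n) (Fin n) ℂ).map MvPolynomial.C)) :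
        Matrix (Fin n) (Fin n) (MvPolynomial (Fin n × Fin n) ℂ)) p.1 p.2)

/-- The invariant ring `ℂ[gl_n(ℂ)]^{GL_n(ℂ)}` of the conjugation action. -/
def glInvariants (n : ℕ) : Subalgebra ℂ (MvPolynomial (Fin n × Fin n) ℂ) where
  carrier := {f | ∀ g : GL (Fin n) ℂ, glConj g f = f}
  mul_mem' := by intro a b ha hb g; rw [_root_.map_mul, ha g, hb g]
  add_mem' := by intro a b ha hb g; rw [_root_.map_add, ha g, hb g]
  one_mem' := by intro g; rw [_root_.map_one]
  zero_mem' := by intro g; rw [_root_.map_zero]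
  algebraMap_mem' := by intro r g; exact AlgHom.commutes _ r

section SymmetricPower

variable {R : Type*} [CommRing R] {n d : ℕ}

/-- The monomial of `R[X₀, …, Xₙ₋₁]` attached to a multiset of `d` indices. -/
def symMonomial (R : Type*) [CommRing R] {n d : ℕ} (a : Sym (Fin n) d) :
    MvPolynomial (Fin n) R :=
  monomial (Multiset.toFinsupp (a : Multiset (Fin n))) 1

/-- The linear substitution `Xᵢ ↦ ∑ⱼ gᵢⱼ Xⱼ`. -/
def linSubst (g : Matrix (Fin n) (Fin n) R) : MvPolynomial (Fin n) R →ₐ[R] MvPolynomial (Fin n) R :=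
  aeval fun i => ∑ j, C (g i j) * X j

/-- The derivation with `Xᵢ ↦ ∑ⱼ Aᵢⱼ Xⱼ`. -/
def linDerivation (A : Matrix (Fin n) (Fin n) R) :
    Derivation R (MvPolynomial (Fin n) R) (MvPolynomial (Fin n) R) :=
  mkDerivation R fun i => ∑ j, C (A i j) * X j

/-- The matrix of `linSubst g` on the monomials of degree `d`. -/
def symPowMat (d : ℕ) (g : Matrix (Fin n) (Fin n) R) : Matrix (Sym (Fin n) d) (Sym (Fin n) d) R :=
  fun a b => coeff (Multiset.toFinsupp (b : Multiset (Fin n))) (linSubst g (symMonomial R a))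

lemma coeff_symMonomial (a b : Sym (Fin n) d) :
    coeff (Multiset.toFinsupp (b : Multiset (Fin n))) (symMonomial R a) = if a = b then 1 else 0 := by
  rw [symMonomial, coeff_monomial]
  congr 1
  rw [Multiset.toFinsupp.injective.eq_iff, Sym.coe_inj]

lemma coeff_sum_smul_symMonomial (v : Sym (Fin n) d → R) (b : Sym (Fin n) d) :
    coeff (Multiset.toFinsupp (b : Multiset (Fin n))) (∑ a, v a • symMonomial R a) = v b := by
  simp [coeff_sum, coeff_symMonomial]

lemma degree_toFinsupp_sym (a : Sym (Fin n) d) :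
    (Multiset.toFinsupp (a : Multiset (Fin n))).degree = d := by
  rw [Finsupp.degree_eq_sum]
  simp only [Multiset.toFinsupp_apply]
  exact (Multiset.sum_count_eq_card fun i _ => Finset.mem_univ i).trans a.2

lemma isHomogeneous_symMonomial (a : Sym (Fin n) d) : (symMonomial R a).IsHomogeneous d :=
  isHomogeneous_monomial _ (degree_toFinsupp_sym a)

lemma MvPolynomial.IsHomogeneous.eq_sum_symMonomial {f : MvPolynomial (Fin n) R}
    (hf : f.IsHomogeneous d) :
    f = ∑ a : Sym (Fin n) d,
      coeff (Multiset.toFinsupp (a : Multiset (Fin n))) f • symMonomial R a := by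
  ext m
  by_cases hm : m.degree = d
  · have hcard : (Finsupp.toMultiset m).card = d := by
      rw [Finsupp.card_toMultiset, ← hm, Finsupp.degree]; rfl
    have := coeff_sum_smul_symMonomial
      (fun a : Sym (Fin n) d => coeff (Multiset.toFinsupp (a : Multiset (Fin n))) f)
      (Sym.mk (Finsupp.toMultiset m) hcard)
    simpa using this.symm
  · rw [hf.coeff_eq_zero hm, IsHomogeneous.coeff_eq_zero _ hm]
    refine IsHomogeneous.sum _ _ _ fun a _ => ?_
    rw [smul_eq_C_mul]
    exact (isHomogeneous_symMonomial a).C_mul _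

lemma linSubst_symMonomial (g : Matrix (Fin n) (Fin n) R) (a : Sym (Fin n) d) :
    linSubst g (symMonomial R a) = ∑ b, symPowMat d g a b • symMonomial R b := by
  refine IsHomogeneous.eq_sum_symMonomial ?_
  have h := (isHomogeneous_symMonomial (R := R) a).aeval (fun i => ∑ j, C (g i j) * X j)
    (n := 1) fun i => IsHomogeneous.sum _ _ _ fun j _ => isHomogeneous_C_mul_X _ _
  rwa [one_mul] at h

lemma linDerivation_symMonomial (A : Matrix (Fin n) (Fin n) R) (a : Sym (Fin n) d) :
    linDerivation A (symMonomial R a) = ∑ b, symMat n d A a b • symMonomial R b := by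
  simp only [symMat, Finset.sum_smul]
  rw [linDerivation, symMonomial, mkDerivation_monomial, one_smul, Finsupp.sum_fintype _ _ (by simp),
    Finset.sum_comm]
  refine Finset.sum_congr rfl fun i _ => ?_
  rw [smul_eq_mul, Finset.mul_sum, Finset.sum_comm]
  refine Finset.sum_congr rfl fun j _ => ?_
  rw [Multiset.toFinsupp_apply]
  by_cases hi : i ∈ (a : Multiset (Fin n))
  · have hcard : ((a : Multiset (Fin n)).erase i + {j}).card = d := by
      rw [Multiset.card_add, Multiset.card_singleton, Multiset.card_erase_add_one hi]
      exact a.2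
    have hexp : Multiset.toFinsupp (a : Multiset (Fin n)) - Finsupp.single i 1 +
        Finsupp.single j 1 = Multiset.toFinsupp ((a : Multiset (Fin n)).erase i + {j}) := by
      rw [Multiset.toFinsupp_add, Multiset.toFinsupp_singleton]
      congr 1
      ext k
      rcases eq_or_ne k i with rfl | hk
      · simp
      · simp [hk]
    rw [Finset.sum_eq_single (Sym.mk _ hcard)]
    · rw [Sym.coe_mk, if_pos rfl, symMonomial, smul_monomial, C_mul_X_eq_monomial, monomial_mul,
        Sym.coe_mk, hexp, smul_eq_mul, mul_one]
    · intro b _ hb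
      have hne : (b : Multiset (Fin n)) ≠ (a : Multiset (Fin n)).erase i + {j} :=
        fun h => hb (Sym.coe_injective h)
      rw [if_neg hne, zero_smul]
    · simp
  · simp [Multiset.count_eq_zero_of_notMem hi]

lemma linSubst_linDerivation {A B g : Matrix (Fin n) (Fin n) R} (h : A * g = g * B)
    (f : MvPolynomial (Fin n) R) :
    linSubst g (linDerivation A f) = linDerivation B (linSubst g f) := by
  induction f using MvPolynomial.induction_on with
  | C r => simp [linSubst]
  | add p q hp hq => simp only [map_add, hp, hq]
  | mul_X p i hp =>
    have hX : linSubst g (linDerivation A (X i)) = linDerivation B (linSubst g (X i)) := by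
      have hi k : ∑ j, A i j * g j k = ∑ j, g i j * B j k := by
        simpa [Matrix.mul_apply] using congr_fun₂ h i k
      simp only [linDerivation, linSubst, mkDerivation_X, aeval_X, map_sum, ← smul_eq_C_mul,
        Derivation.map_smul, Finset.smul_sum, smul_smul, map_smul]
      rw [Finset.sum_comm]
      conv_rhs => rw [Finset.sum_comm]
      simp only [← Finset.sum_smul, hi]
    simp only [Derivation.leibniz, map_mul, map_add, smul_eq_mul, hp, hX]

lemma linSubst_linSubst (g h : Matrix (Fin n) (Fin n) R) (f : MvPolynomial (Fin n) R) :
    linSubst h (linSubst g f) = linSubst (g * h) f := by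
  suffices H : (linSubst h).comp (linSubst g) = linSubst (g * h) from DFunLike.congr_fun H f
  refine algHom_ext fun i => ?_
  simp only [AlgHom.comp_apply, linSubst, aeval_X, map_sum, ← smul_eq_C_mul, map_smul,
    Finset.smul_sum, smul_smul, Matrix.mul_apply, Finset.sum_mul]
  exact Finset.sum_comm

lemma linSubst_one (f : MvPolynomial (Fin n) R) : linSubst (1 : Matrix (Fin n) (Fin n) R) f = f := by
  have : linSubst (1 : Matrix (Fin n) (Fin n) R) = AlgHom.id R _ :=
    algHom_ext fun i => by simp [linSubst, Matrix.one_apply]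
  rw [this, AlgHom.id_apply]

lemma sum_smul_sum_smul_symMonomial (M N : Matrix (Sym (Fin n) d) (Sym (Fin n) d) R)
    (a : Sym (Fin n) d) :
    ∑ b, M a b • ∑ c, N b c • symMonomial R c = ∑ c, (M * N) a c • symMonomial R c := by
  simp only [Finset.smul_sum, smul_smul, Matrix.mul_apply, Finset.sum_smul]
  exact Finset.sum_comm

lemma matrix_ext_symMonomial {M N : Matrix (Sym (Fin n) d) (Sym (Fin n) d) R}
    (h : ∀ a, ∑ b, M a b • symMonomial R b = ∑ b, N a b • symMonomial R b) : M = N := by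
  ext a b
  rw [← coeff_sum_smul_symMonomial (M a) b, h, coeff_sum_smul_symMonomial]

lemma symPowMat_mul (g h : Matrix (Fin n) (Fin n) R) :
    symPowMat d g * symPowMat d h = symPowMat d (g * h) := by
  refine matrix_ext_symMonomial fun a => ?_
  rw [← sum_smul_sum_smul_symMonomial, ← linSubst_symMonomial, ← linSubst_linSubst,
    linSubst_symMonomial g, map_sum]
  simp only [map_smul, linSubst_symMonomial]

lemma symPowMat_one : symPowMat d (1 : Matrix (Fin n) (Fin n) R) = 1 := by
  ext a b
  rw [symPowMat, linSubst_one, coeff_symMonomial, Matrix.one_apply]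

lemma symMat_mul_symPowMat {A B g : Matrix (Fin n) (Fin n) R} (h : A * g = g * B) :
    symMat n d A * symPowMat d g = symPowMat d g * symMat n d B := by
  refine matrix_ext_symMonomial fun a => ?_
  have key := linSubst_linDerivation h (symMonomial R a)
  simp only [linDerivation_symMonomial, linSubst_symMonomial, map_sum, map_smul,
    Derivation.map_smul, sum_smul_sum_smul_symMonomial] at key
  exact key

lemma symMat_map {S : Type*} [CommRing S] (f : R →+* S) (A : Matrix (Fin n) (Fin n) R) :
    (symMat n d A).map f = symMat n d (A.map f) := by
  ext a b
  simp only [symMat, Matrix.map_apply, map_sum, apply_ite f, map_mul, map_natCast, map_zero]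

end SymmetricPower

section CharP

variable {m R S : Type*} [Fintype m] [DecidableEq m] [CommRing R] [CommRing S]

lemma charP_eq_charpoly_neg (M : Matrix m m R) : charP M = (-M).charpoly := by
  rw [_root_.charP, Matrix.charpoly, Matrix.charmatrix]
  congr 1
  ext i j : 1
  simp [Matrix.one_apply, Matrix.diagonal_apply]

lemma charP_map (f : R →+* S) (M : Matrix m m R) :
    charP (M.map f) = Polynomial.map f (charP M) := by
  rw [charP_eq_charpoly_neg, charP_eq_charpoly_neg, ← Matrix.charpoly_map]
  congr 1
  ext i j
  simp

lemma charP_eq_of_conj {M N P Q : Matrix m m R} (hPQ : P * Q = 1) (h : M * P = P * N) :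
    charP M = charP N := by
  have hM : -M = P * (-N * Q) := by
    rw [Matrix.neg_mul, Matrix.mul_neg, ← Matrix.mul_assoc, ← h, Matrix.mul_assoc, hPQ,
      Matrix.mul_one]
  rw [charP_eq_charpoly_neg, charP_eq_charpoly_neg, hM, Matrix.charpoly_mul_comm,
    Matrix.mul_assoc, mul_eq_one_comm.mp hPQ, Matrix.mul_one]

end CharP

/-- Characteristic polynomials on symmetric powers are invariant under conjugation. -/
lemma charP_symMat_conj {R : Type*} [CommRing R] {n : ℕ} (d : ℕ)
    {g h : Matrix (Fin n) (Fin n) R} (hgh : g * h = 1) (A : Matrix (Fin n) (Fin n) R) :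
    charP (symMat n d (g * A * h)) = charP (symMat n d A) := by
  refine charP_eq_of_conj (P := symPowMat d g) (Q := symPowMat d h) ?_ (symMat_mul_symPowMat ?_)
  · rw [symPowMat_mul, hgh, symPowMat_one]
  · rw [Matrix.mul_assoc, mul_eq_one_comm.mp hgh, Matrix.mul_one]

lemma glGen_map_glConj {n : ℕ} (g : GL (Fin n) ℂ) :
    (glGen n).map (glConj g).toRingHom =
      (g : Matrix (Fin n) (Fin n) ℂ).map MvPolynomial.C * glGen n *
        ((g⁻¹ : GL (Fin n) ℂ) : Matrix (Fin n) (Fin n) ℂ).map MvPolynomial.C := by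
  ext1 i j
  exact aeval_X _ _

/-- the characteristic polynomial of `gl_n(ℂ)` on `S^d(ℂ^n)` is invariant
under the conjugation action of `GL_n(ℂ)` extended to `ℂ[x₀, x_{ij}]` by fixing `x₀`;
equivalently, every coefficient `z_i` of the characteristic polynomial is a conjugation
invariant of `GL_n(ℂ)`. -/
theorem charP_gl_symPow_invariant (n d : ℕ) (hn : 2 ≤ n) (hd : 1 ≤ d) :
    (∀ g : GL (Fin n) ℂ,
      Polynomial.map (glConj g).toRingHom (charP (symMat n d (glGen n))) =
        charP (symMat n d (glGen n))) ∧
    (∀ (g : GL (Fin n) ℂ) (i : ℕ),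
      glConj g ((charP (symMat n d (glGen n))).coeff i) =
        (charP (symMat n d (glGen n))).coeff i) := by
  have hmap (g : GL (Fin n) ℂ) :
      Polynomial.map (glConj g).toRingHom (charP (symMat n d (glGen n))) =
        charP (symMat n d (glGen n)) := by
    rw [← charP_map, symMat_map, glGen_map_glConj]
    refine charP_symMat_conj d ?_ _
    rw [← Matrix.map_mul, ← Units.val_mul, mul_inv_cancel, Units.val_one,
      Matrix.map_one _ (map_zero _) (map_one _)]
  refine ⟨hmap, fun g i => ?_⟩
  conv_rhs => rw [← hmap g, Polynomial.coeff_map]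
  rfl
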